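/- arXiv:2105.04755 — 6 statements merged into one kernel-verified Lean document; each statement's English description precedes it below -/
import Mathlib

section
/- Let k ≥ 1 be an integer and let X_1, …, X_k be nonempty connected subsets of ℝ (i.e., nonempty intervals, which may be open, half-open, closed, bounded or unbounded). Then there exists an index j* ∈ {1,…,k} such that X_{j*} is 0-good with respect to the family (X_1,…,X_k): for all j_1, j_2 ∈ {1,…,k}, if X_{j_1} ∩ X_{j*} ≠ ∅ and X_{j_2} ∩ X_{j*} ≠ ∅, then X_{j_1} ∩ X_{j_2} ≠ ∅. -/
/-- If the down-set generated by `t` contains `u`, then an order-connected `t` contains every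
point of `u` that lies above some point of `t`. -/
theorem Set.OrdConnected.mem_of_subset_lowerClosure {α : Type*} [Preorder α] {t u : Set α}
    (ht : t.OrdConnected) (hut : u ⊆ lowerClosure t) {a b : α} (ha : a ∈ t) (hb : b ∈ u)
    (hab : a ≤ b) : b ∈ t := by
  obtain ⟨c, hc, hbc⟩ := hut hb
  exact ht.out ha hc ⟨hab, hbc⟩

/-- In a finite nonempty family of order-connected sets of a linear order, a member generating
the smallest down-set has pairwise intersecting neighbours. -/
theorem exists_forall_inter_nonempty_of_ordConnected {ι α : Type*} [Finite ι] [Nonempty ι]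
    [LinearOrder α] (X : ι → Set α) (hconn : ∀ j, (X j).OrdConnected) :
    ∃ i, ∀ j₁ j₂, (X j₁ ∩ X i).Nonempty → (X j₂ ∩ X i).Nonempty → (X j₁ ∩ X j₂).Nonempty := by
  obtain ⟨i, hi⟩ := Finite.exists_min fun j => lowerClosure (X j)
  have hsub (j : ι) : X i ⊆ lowerClosure (X j) := subset_lowerClosure.trans (hi j)
  refine ⟨i, fun j₁ j₂ ⟨a, ha, hai⟩ ⟨b, hb, hbi⟩ => ?_⟩
  rcases le_total a b with hab | hba
  · exact ⟨b, (hconn j₁).mem_of_subset_lowerClosure (hsub j₁) ha hbi hab, hb⟩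
  · exact ⟨a, ha, (hconn j₂).mem_of_subset_lowerClosure (hsub j₂) hb hai hba⟩


/-- Among finitely many nonempty connected (i.e., order-connected) subsets of ℝ,
some member `X j*` is 0-good: any two members that intersect `X j*` intersect each other. -/
theorem zero_good_piece_exists_interval (k : ℕ) (hk : 1 ≤ k) (X : Fin k → Set ℝ)
    (hne : ∀ j, (X j).Nonempty) (hconn : ∀ j, (X j).OrdConnected) :
    ∃ jstar : Fin k, ∀ j1 j2 : Fin k,
      (X j1 ∩ X jstar).Nonempty → (X j2 ∩ X jstar).Nonempty →
      (X j1 ∩ X j2).Nonempty := by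
  have : Nonempty (Fin k) := ⟨⟨0, hk⟩⟩
  exact exists_forall_inter_nonempty_of_ordConnected X hconn
end

section
/- Let G be a finite tree, i.e., a simple graph on a finite nonempty vertex set V that is connected and acyclic. Let k ≥ 1 and let X_1, …, X_k be nonempty subsets of V, each of which induces a connected subgraph of G. Then there exists an index j* ∈ {1,…,k} such that for all j_1, j_2 ∈ {1,…,k}: if X_{j_1} ∩ X_{j*} ≠ ∅ and X_{j_2} ∩ X_{j*} ≠ ∅, then X_{j_1} ∩ X_{j_2} ≠ ∅. -/
namespace SimpleGraph

variable {V : Type*} {G : SimpleGraph V}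

/-- Every vertex other than the first on a shortest walk to `r` is strictly closer to `r`
than the first one. -/
lemma Walk.eq_of_mem_support_of_dist_le {v r y : V} {g : G.Walk v r}
    (hg : g.length = G.dist v r) (hy : y ∈ g.support) (hle : G.dist v r ≤ G.dist y r) :
    y = v := by
  classical
  have hlen := congrArg Walk.length (g.take_spec hy)
  rw [Walk.length_append] at hlen
  have hdrop := dist_le (g.dropUntil y hy)
  exact (Walk.eq_of_length_eq_zero (p := g.takeUntil y hy) (by omega)).symm

lemma exists_isPath_support_subset_of_induce_connected {S : Set V}
    (hS : (G.induce S).Connected) {x v : V} (hx : x ∈ S) (hv : v ∈ S) :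
    ∃ w : G.Walk x v, w.IsPath ∧ ∀ y ∈ w.support, y ∈ S := by
  obtain ⟨w, hw⟩ := hS.exists_isPath ⟨x, hx⟩ ⟨v, hv⟩
  refine ⟨w.map (Embedding.induce S).toHom, hw.map Subtype.val_injective, ?_⟩
  intro y hy
  obtain ⟨z, -, rfl⟩ := List.mem_map.1 ((Walk.support_map (Embedding.induce S).toHom w) ▸ hy)
  exact z.2

/-- In a tree, the path from a point of a subtree `S` to `r` runs inside `S` at least until it is
closer to `r` than a given point of `S`. -/
lemma IsTree.mem_of_mem_support_of_dist_le (hG : G.IsTree) {S : Set V}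
    (hS : (G.induce S).Connected) {x v r y : V} (hx : x ∈ S) (hv : v ∈ S)
    {p : G.Walk x r} (hp : p.IsPath) (hy : y ∈ p.support) (hle : G.dist v r ≤ G.dist y r) :
    y ∈ S := by
  classical
  obtain ⟨w, -, hwS⟩ := exists_isPath_support_subset_of_induce_connected hS hx hv
  obtain ⟨g, hg⟩ := hG.connected.exists_walk_length_eq_dist v r
  have hpw : p = (w.append g).bypass :=
    congrArg Subtype.val ((hG.isAcyclic.subsingleton_path x r).elim ⟨p, hp⟩ ⟨_, (w.append g).bypass_isPath⟩)
  rw [hpw] at hy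
  rcases (Walk.mem_support_append_iff w g).1 (Walk.support_bypass_subset_support _ hy) with hy | hy
  · exact hwS y hy
  · rwa [Walk.eq_of_mem_support_of_dist_le hg hy hle]

/-- In a tree, the path from a point of a subtree `S` to `r` passes through the point of `S`
closest to `r`. -/
lemma IsTree.mem_support_of_forall_dist_le (hG : G.IsTree) {S : Set V}
    (hS : (G.induce S).Connected) {x v r : V} (hx : x ∈ S) (hv : v ∈ S)
    (hmin : ∀ y ∈ S, G.dist v r ≤ G.dist y r) {p : G.Walk x r} (hp : p.IsPath) :
    v ∈ p.support := by
  obtain ⟨w, hw, hwS⟩ := exists_isPath_support_subset_of_induce_connected hS hx hv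
  obtain ⟨g, hgp, hg⟩ := hG.connected.exists_path_of_dist v r
  have hpath : (w.append g).IsPath := by
    have hgn := hgp.support_nodup
    rw [← Walk.cons_tail_support, List.nodup_cons] at hgn
    rw [Walk.isPath_def, Walk.support_append, List.nodup_append']
    refine ⟨hw.support_nodup, hgn.2, fun y hyw hyg ↦ hgn.1 ?_⟩
    have hyv := Walk.eq_of_mem_support_of_dist_le hg (List.mem_of_mem_tail hyg)
      (hmin y (hwS y hyw))
    exact hyv ▸ hyg
  have hpw : p = w.append g :=
    congrArg Subtype.val ((hG.isAcyclic.subsingleton_path x r).elim ⟨p, hp⟩ ⟨_, hpath⟩)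
  rw [hpw, Walk.mem_support_append_iff]
  exact Or.inl w.end_mem_support

end SimpleGraph

/-- Let `G` be a finite tree and `X 1, …, X k` nonempty vertex subsets, each
inducing a connected subgraph. Then some `X j*` is 0-good: any two subsets intersecting
`X j*` intersect each other. -/
theorem zero_good_piece_exists_tree {V : Type*} [Fintype V] [Nonempty V]
    (G : SimpleGraph V) (hG : G.IsTree)
    (k : ℕ) (hk : 1 ≤ k) (X : Fin k → Set V)
    (hne : ∀ j, (X j).Nonempty)
    (hconn : ∀ j, (G.induce (X j)).Connected) :
    ∃ jstar : Fin k, ∀ j1 j2 : Fin k,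
      (X j1 ∩ X jstar).Nonempty → (X j2 ∩ X jstar).Nonempty →
      (X j1 ∩ X j2).Nonempty := by
  have : Nonempty (Fin k) := ⟨⟨0, hk⟩⟩
  obtain ⟨r⟩ := ‹Nonempty V›
  choose v hv hmin using fun j ↦
    (X j).toFinite.exists_minimalFor (fun y ↦ G.dist y r) (X j) (hne j)
  replace hmin : ∀ j, ∀ y ∈ X j, G.dist (v j) r ≤ G.dist y r := fun j y hy ↦
    (le_total _ _).elim id (hmin j hy)
  obtain ⟨s, hs⟩ := Finite.exists_max fun j ↦ G.dist (v j) r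
  have key : ∀ j, (X j ∩ X s).Nonempty → v s ∈ X j := by
    rintro j ⟨x, hxj, hxs⟩
    obtain ⟨p, hp⟩ := hG.connected.exists_isPath x r
    exact hG.mem_of_mem_support_of_dist_le (hconn j) hxj (hv j) hp
      (hG.mem_support_of_forall_dist_le (hconn s) hxs (hv s) (hmin s) hp) (hs j)
  exact ⟨s, fun j1 j2 h1 h2 ↦ ⟨v s, key j1 h1, key j2 h2⟩⟩
end

section
/- Let s > 0 be a real number, let k ≥ 1 be an integer, and let X_1, …, X_k be nonempty closed connected subsets of ℝ. Then there exists an index j* ∈ {1,…,k} such that X_{j*} is s-good: for all j_1, j_2 ∈ {1,…,k}, if there exist points x ∈ X_{j_1}, y ∈ X_{j*} with |x − y| < s and points x' ∈ X_{j_2}, y' ∈ X_{j*} with |x' − y'| < s, then there exist points u ∈ X_{j_1}, w ∈ X_{j_2} with |u − w| < s. -/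
/-- An order-connected set with a point below `m + s` and a point at or above `m`
meets `[m, m + s)`. -/
theorem Set.OrdConnected.exists_mem_Ico_add {A : Set ℝ} (hA : A.OrdConnected) {s m x z : ℝ}
    (hs : 0 < s) (hx : x ∈ A) (hxm : x < m + s) (hz : z ∈ A) (hmz : m ≤ z) :
    ∃ u ∈ A, u ∈ Set.Ico m (m + s) := by
  rcases le_total m x with h | h
  · exact ⟨x, hx, h, hxm⟩
  · exact ⟨m, hA.out hx hz ⟨h, hmz⟩, le_rfl, by linarith⟩

/-- Among finitely many nonempty closed connected subsets of ℝ, for any `s > 0`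
some member `X j*` is `s`-good: whenever `X j1` and `X j2` each come within distance `< s`
of `X j*`, they come within distance `< s` of each other. -/
theorem s_good_piece_exists_interval (s : ℝ) (hs : 0 < s) (k : ℕ) (hk : 1 ≤ k)
    (X : Fin k → Set ℝ) (hne : ∀ j, (X j).Nonempty)
    (hcl : ∀ j, IsClosed (X j)) (hconn : ∀ j, (X j).OrdConnected) :
    ∃ jstar : Fin k, ∀ j1 j2 : Fin k,
      (∃ x ∈ X j1, ∃ y ∈ X jstar, |x - y| < s) →
      (∃ x' ∈ X j2, ∃ y' ∈ X jstar, |x' - y'| < s) →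
      ∃ u ∈ X j1, ∃ w ∈ X j2, |u - w| < s := by
  have : Nonempty (Fin k) := ⟨⟨0, hk⟩⟩
  obtain ⟨i, hi⟩ := Finite.exists_min fun j => lowerClosure (X j)
  refine ⟨i, ?_⟩
  rintro j₁ j₂ ⟨x, hx, y, hy, hxy⟩ ⟨x', hx', y', hy', hxy'⟩
  have key : ∀ j, ∃ z ∈ X j, max y y' ≤ z := fun j =>
    mem_lowerClosure.1 (hi j (subset_lowerClosure (max_rec' (· ∈ X i) hy hy')))
  obtain ⟨z, hz, hmz⟩ := key j₁
  obtain ⟨z', hz', hmz'⟩ := key j₂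
  rw [abs_lt] at hxy hxy'
  obtain ⟨u, hu, hmu, hus⟩ := (hconn j₁).exists_mem_Ico_add hs hx
    (by linarith [le_max_left y y']) hz hmz
  obtain ⟨w, hw, hmw, hws⟩ := (hconn j₂).exists_mem_Ico_add hs hx'
    (by linarith [le_max_right y y']) hz' hmz'
  exact ⟨u, hu, w, hw, abs_lt.2 ⟨by linarith, by linarith⟩⟩
end

section
/- Let G be a finite tree, i.e., a simple graph on a finite nonempty vertex set V that is connected and acyclic, and let s ≥ 1 be a natural number. Let k ≥ 1 and let X_1, …, X_k be nonempty subsets of V, each inducing a connected subgraph of G. Then there exists an index j* ∈ {1,…,k} such that for all j_1, j_2 ∈ {1,…,k}: if there exist vertices x ∈ X_{j_1}, y ∈ X_{j*} with graph distance d_G(x,y) < s and vertices x' ∈ X_{j_2}, y' ∈ X_{j*} with d_G(x',y') < s, then there exist vertices u ∈ X_{j_1}, w ∈ X_{j_2} with d_G(u,w) < s. -/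
namespace SimpleGraph

variable {V : Type*} {G : SimpleGraph V}

lemma Walk.IsPath.append_of_inter_subset {u v w : V} {p : G.Walk u v} {q : G.Walk v w}
    (hp : p.IsPath) (hq : q.IsPath) (h : ∀ x ∈ p.support, x ∈ q.support → x = v) :
    (p.append q).IsPath := by
  rw [Walk.isPath_def, Walk.support_append]
  refine hp.support_nodup.append (hq.support_nodup.sublist (List.tail_sublist _)) ?_
  intro x hxp hxq
  obtain rfl := h x hxp (List.mem_of_mem_tail hxq)
  have hn := hq.support_nodup
  rw [← Walk.cons_tail_support, List.nodup_cons] at hn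
  exact hn.1 hxq

/-- A connected set of vertices contains a path between any two of its vertices. -/
lemma Connected.exists_isPath_support_subset {X : Set V} (hX : (G.induce X).Connected) {u v : V}
    (hu : u ∈ X) (hv : v ∈ X) : ∃ p : G.Walk u v, p.IsPath ∧ ∀ x ∈ p.support, x ∈ X := by
  obtain ⟨q, hq, -⟩ := hX.exists_path_of_dist ⟨u, hu⟩ ⟨v, hv⟩
  refine ⟨q.map (Embedding.induce X).toHom,
    (Walk.isPath_map_iff_of_injective Subtype.val_injective).2 hq, ?_⟩
  intro x hx
  obtain ⟨y, -, rfl⟩ := List.mem_map.1 <|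
    (congrArg (x ∈ ·) (Walk.support_map (Embedding.induce X).toHom q)).mp hx
  exact y.2

namespace IsTree

lemma length_eq_dist (hG : G.IsTree) {u v : V} {p : G.Walk u v} (hp : p.IsPath) :
    p.length = G.dist u v := by
  obtain ⟨q, hq, hlen⟩ := hG.connected.exists_path_of_dist u v
  rw [(hG.existsUnique_path u v).unique hp hq, hlen]

lemma dist_add_dist_of_mem_support (hG : G.IsTree) {u v m : V} {p : G.Walk u v} (hp : p.IsPath)
    (hm : m ∈ p.support) : G.dist u m + G.dist m v = G.dist u v := by
  classical
  rw [← hG.length_eq_dist hp, ← hG.length_eq_dist (hp.takeUntil hm),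
    ← hG.length_eq_dist (hp.dropUntil hm), ← Walk.length_append, Walk.take_spec]

/-- Every vertex of a tree has a gate in each connected set of vertices. -/
lemma exists_gate (hG : G.IsTree) {X : Set V} (hX : (G.induce X).Connected) (z : V) :
    ∃ m ∈ X, ∀ w ∈ X, G.dist z w = G.dist z m + G.dist m w := by
  classical
  obtain ⟨⟨m, hm⟩, hmin⟩ : ∃ m : X, ∀ w : X, G.dist z m ≤ G.dist z w := by
    have := hX.nonempty
    exact ⟨Function.argmin (fun w : X ↦ G.dist z w),
      fun w ↦ Function.argmin_le (fun w : X ↦ G.dist z w) w⟩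
  refine ⟨m, hm, fun w hw ↦ ?_⟩
  obtain ⟨p, hp, hpX⟩ := hX.exists_isPath_support_subset hm hw
  obtain ⟨q, hq, -⟩ := hG.connected.exists_path_of_dist z m
  have hqp : (q.append p).IsPath := hq.append_of_inter_subset hp fun x hxq hxp ↦ by
    have h₁ := hG.dist_add_dist_of_mem_support hq hxq
    have h₂ := hmin ⟨x, hpX x hxp⟩
    exact hG.connected.dist_eq_zero_iff.1 (by dsimp only at h₂; omega)
  exact (hG.dist_add_dist_of_mem_support hqp (by simp)).symm

/-- The four-point condition for the metric of a tree. -/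
lemma dist_add_dist_le_max (hG : G.IsTree) (x y z w : V) :
    G.dist x y + G.dist z w ≤
      max (G.dist x z + G.dist y w) (G.dist x w + G.dist y z) := by
  classical
  obtain ⟨p, hp, -⟩ := hG.connected.exists_path_of_dist x y
  have hX : (G.induce {v | v ∈ p.support}).Connected := p.connected_induce_support
  obtain ⟨m, hm, hmz⟩ := hG.exists_gate hX z
  obtain ⟨n, hn, hnw⟩ := hG.exists_gate hX w
  have hzx := hmz x p.start_mem_support
  have hzy := hmz y p.end_mem_support
  have hwx := hnw x p.start_mem_support
  have hwy := hnw y p.end_mem_support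
  have hxm := hG.dist_add_dist_of_mem_support hp hm
  have hxn := hG.dist_add_dist_of_mem_support hp hn
  have hzw : G.dist z w ≤ G.dist z m + G.dist m w := hG.connected.dist_triangle
  have hmw : G.dist m w ≤ G.dist m n + G.dist n w := hG.connected.dist_triangle
  have hmn : G.dist x n + G.dist n m = G.dist x m ∨ G.dist m n + G.dist n y = G.dist m y := by
    have hn' : n ∈ p.support := hn
    rw [← p.take_spec hm, Walk.mem_support_append_iff] at hn'
    exact hn'.imp (hG.dist_add_dist_of_mem_support (hp.takeUntil hm))
      (hG.dist_add_dist_of_mem_support (hp.dropUntil hm))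
  rw [G.dist_comm (u := z) (v := x), G.dist_comm (u := m) (v := x)] at hzx
  rw [G.dist_comm (u := z) (v := y)] at hzy
  rw [G.dist_comm (u := w) (v := x), G.dist_comm (u := n) (v := x)] at hwx
  rw [G.dist_comm (u := w) (v := y)] at hwy
  rw [G.dist_comm (u := n) (v := w)] at hmw
  rw [G.dist_comm (u := n) (v := m)] at hmn
  omega

/-- Moving from `x` towards the gate `a` of `r`, a connected set meets every level between them. -/
lemma exists_mem_dist_eq (hG : G.IsTree) {X : Set V} (hX : (G.induce X).Connected) {r a x : V}
    (ha : a ∈ X) (hx : x ∈ X) (hgate : ∀ w ∈ X, G.dist r w = G.dist r a + G.dist a w) {n : ℕ}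
    (han : G.dist r a ≤ n) (hnx : n ≤ G.dist r x) :
    ∃ m ∈ X, G.dist r m = n ∧ G.dist r x = n + G.dist m x := by
  obtain ⟨p, hp, hpX⟩ := hX.exists_isPath_support_subset ha hx
  have hlen := hG.length_eq_dist hp
  have htake := hG.length_eq_dist (hp.take (n - G.dist r a))
  rw [Walk.take_length] at htake
  have hmem := p.getVert_mem_support (n - G.dist r a)
  refine ⟨p.getVert (n - G.dist r a), hpX _ hmem, ?_⟩
  have hadd := hG.dist_add_dist_of_mem_support hp hmem
  have h₁ := hgate _ (hpX _ hmem)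
  have h₂ := hgate _ hx
  omega

/-- If `X` comes within distance `s` of a connected set `Y`, and the gate of `X` is at most as far
from `r` as the gate `a` of `Y`, then some vertex of `X` no farther from `r` than `a` is
within distance `s` of `a`. -/
lemma exists_mem_dist_le_dist_lt (hG : G.IsTree) {X Y : Set V} (hX : (G.induce X).Connected)
    {r a b : V} (hb : b ∈ X) (hbX : ∀ w ∈ X, G.dist r w = G.dist r b + G.dist b w)
    (haY : ∀ w ∈ Y, G.dist r w = G.dist r a + G.dist a w) (hba : G.dist r b ≤ G.dist r a)
    {s : ℕ} {x y : V} (hx : x ∈ X) (hy : y ∈ Y) (hxy : G.dist x y < s) :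
    ∃ m ∈ X, G.dist r m ≤ G.dist r a ∧ G.dist m a < s := by
  have hry := haY y hy
  have h₁ := hG.dist_add_dist_le_max r y a x
  rw [G.dist_comm (u := y) (v := x), G.dist_comm (u := y) (v := a)] at h₁
  rcases lt_or_ge (G.dist r x) (G.dist r a) with hlt | hle
  · refine ⟨x, hx, hlt.le, ?_⟩
    rw [G.dist_comm]
    omega
  · obtain ⟨m, hm, hrm, hrx⟩ := hG.exists_mem_dist_eq hX hb hx hbX hba hle
    refine ⟨m, hm, hrm.le, ?_⟩
    have h₂ := hG.dist_add_dist_le_max r x m a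
    rw [G.dist_comm (u := x) (v := a), G.dist_comm (u := x) (v := m)] at h₂
    omega

end IsTree

end SimpleGraph


/-- Let `G` be a finite tree, `s ≥ 1` a natural number, and `X 1, …, X k`
nonempty vertex subsets each inducing a connected subgraph. Then some `X j*` is `s`-good
with respect to the shortest-path distance: whenever `X j1` and `X j2` each contain a
vertex at distance `< s` from `X j*`, they contain vertices at distance `< s` from each
other. -/
theorem s_good_piece_exists_tree {V : Type*} [Fintype V] [Nonempty V]
    (G : SimpleGraph V) (hG : G.IsTree) (s : ℕ) (hs : 1 ≤ s)
    (k : ℕ) (hk : 1 ≤ k) (X : Fin k → Set V)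
    (hne : ∀ j, (X j).Nonempty)
    (hconn : ∀ j, (G.induce (X j)).Connected) :
    ∃ jstar : Fin k, ∀ j1 j2 : Fin k,
      (∃ x ∈ X j1, ∃ y ∈ X jstar, G.dist x y < s) →
      (∃ x' ∈ X j2, ∃ y' ∈ X jstar, G.dist x' y' < s) →
      ∃ u ∈ X j1, ∃ w ∈ X j2, G.dist u w < s := by
  obtain ⟨r⟩ := ‹Nonempty V›
  have : Nonempty (Fin k) := ⟨⟨0, hk⟩⟩
  choose a ha hgate using fun j ↦ hG.exists_gate (hconn j) r
  obtain ⟨jstar, hmax⟩ := Finite.exists_max fun j ↦ G.dist r (a j)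
  refine ⟨jstar, fun j1 j2 ⟨x, hx, y, hy, hxy⟩ ⟨x', hx', y', hy', hxy'⟩ ↦ ?_⟩
  obtain ⟨u, hu, hru, hua⟩ := hG.exists_mem_dist_le_dist_lt (hconn j1) (ha j1) (hgate j1)
    (hgate jstar) (hmax j1) hx hy hxy
  obtain ⟨w, hw, hrw, hwa⟩ := hG.exists_mem_dist_le_dist_lt (hconn j2) (ha j2) (hgate j2)
    (hgate jstar) (hmax j2) hx' hy' hxy'
  refine ⟨u, hu, w, hw, ?_⟩
  have h := hG.dist_add_dist_le_max u w r (a jstar)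
  rw [G.dist_comm (u := u) (v := r), G.dist_comm (u := w) (v := r)] at h
  omega
end

section
/- Let s > 0 and n ≥ 1, and let μ_1, …, μ_n be finite Borel measures on ℝ that are nonatomic (μ_i({x}) = 0 for every point x). A piece is a subset of [0,1] that is either empty or a closed interval [a,b] with 0 ≤ a ≤ b ≤ 1. For each agent i define MMS_i := sup over all s-separated families (P_1,…,P_n) of pieces of min_{1≤j≤n} μ_i(P_j). Then there exists an s-separated family (A_1,…,A_n) of pieces such that μ_i(A_i) ≥ MMS_i for every i ∈ {1,…,n}. -/
open MeasureTheory

/-- A piece of the interval cake `[0,1]`: either empty or a closed interval `[a,b]` with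
`0 ≤ a ≤ b ≤ 1`. -/
def IsIntervalPiece (P : Set ℝ) : Prop :=
  P = ∅ ∨ ∃ a b : ℝ, 0 ≤ a ∧ a ≤ b ∧ b ≤ 1 ∧ P = Set.Icc a b

/-- A family of sets is `s`-separated if any two points of distinct members are at
distance at least `s`. -/
def IsSepFamily {m : ℕ} (s : ℝ) (P : Fin m → Set ℝ) : Prop :=
  ∀ i j : Fin m, i ≠ j → ∀ x ∈ P i, ∀ y ∈ P j, s ≤ dist x y

/-- The intervals `[a j, b j] ⊆ [0,1]` are pairwise at distance at least `s`. -/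
def IsSepIntervals {ι : Type*} (s : ℝ) (a b : ι → ℝ) : Prop :=
  (∀ j, 0 ≤ a j ∧ a j ≤ b j ∧ b j ≤ 1) ∧
    ∀ i j, i ≠ j → b i + s ≤ a j ∨ b j + s ≤ a i

theorem sep_Icc_iff {s a b c d : ℝ} (hs : 0 < s) (hab : a ≤ b) (hcd : c ≤ d) :
    (∀ x ∈ Set.Icc a b, ∀ y ∈ Set.Icc c d, s ≤ dist x y) ↔ b + s ≤ c ∨ d + s ≤ a := by
  constructor
  · intro h
    rcases lt_or_ge b c with hbc | hcb
    · have := h b ⟨hab, le_rfl⟩ c ⟨le_rfl, hcd⟩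
      rw [Real.dist_eq, abs_of_neg (by linarith)] at this
      exact Or.inl (by linarith)
    rcases lt_or_ge d a with hda | had
    · have := h a ⟨le_rfl, hab⟩ d ⟨hcd, le_rfl⟩
      rw [Real.dist_eq, abs_of_pos (by linarith)] at this
      exact Or.inr (by linarith)
    · have := h (max a c) ⟨le_max_left _ _, max_le hab hcb⟩ (max a c)
        ⟨le_max_right _ _, max_le had hcd⟩
      rw [dist_self] at this
      linarith
  · rintro h x ⟨hax, hxb⟩ y ⟨hcy, hyd⟩
    rw [Real.dist_eq]
    rcases h with h | h
    · exact le_trans (by linarith) (neg_le_abs (x - y))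
    · exact le_trans (by linarith) (le_abs_self (x - y))

/-- A separated family of nonempty pieces consists of separated intervals. -/
theorem exists_isSepIntervals {n : ℕ} {s : ℝ} (hs : 0 < s) {P : Fin n → Set ℝ}
    (hP : ∀ j, IsIntervalPiece (P j)) (hsep : IsSepFamily s P) (hne : ∀ j, (P j).Nonempty) :
    ∃ a b : Fin n → ℝ, IsSepIntervals s a b ∧ ∀ j, P j = Set.Icc (a j) (b j) := by
  have h : ∀ j, ∃ a b : ℝ, 0 ≤ a ∧ a ≤ b ∧ b ≤ 1 ∧ P j = Set.Icc a b := fun j =>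
    (hP j).resolve_left (hne j).ne_empty
  choose a b h0 hab h1 hPab using h
  refine ⟨a, b, ⟨fun j => ⟨h0 j, hab j, h1 j⟩, fun i j hij => ?_⟩, hPab⟩
  rw [← sep_Icc_iff hs (hab i) (hab j), ← hPab, ← hPab]
  exact hsep i j hij

theorem isCompact_setOf_isSepIntervals {ι : Type*} (s : ℝ) :
    IsCompact {p : (ι → ℝ) × (ι → ℝ) | IsSepIntervals s p.1 p.2} := by
  have hK : IsCompact ((Set.univ.pi fun _ : ι => Set.Icc (0 : ℝ) 1) ×ˢ
      (Set.univ.pi fun _ : ι => Set.Icc (0 : ℝ) 1)) :=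
    (isCompact_univ_pi fun _ => isCompact_Icc).prod (isCompact_univ_pi fun _ => isCompact_Icc)
  refine hK.of_isClosed_subset ?_ ?_
  · simp only [IsSepIntervals, Set.ofPred_and, Set.ofPred_forall, Set.ofPred_or]
    refine IsClosed.inter (isClosed_iInter fun j => ?_)
      (isClosed_iInter fun i => isClosed_iInter fun j => isClosed_iInter fun _ => ?_)
    · exact (isClosed_le (by fun_prop) (by fun_prop)).inter
        ((isClosed_le (by fun_prop) (by fun_prop)).inter
          (isClosed_le (by fun_prop) (by fun_prop)))
    · exact (isClosed_le (by fun_prop) (by fun_prop)).union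
        (isClosed_le (by fun_prop) (by fun_prop))
  · rintro p ⟨hp, -⟩
    exact ⟨fun j _ => ⟨(hp j).1, (hp j).2.1.trans (hp j).2.2⟩,
      fun j _ => ⟨(hp j).1.trans (hp j).2.1, (hp j).2.2⟩⟩

/-- A finite measure without atoms has a continuous distribution function. -/
theorem exists_continuous_measureReal_Icc_eq_sub (μ : Measure ℝ) [IsFiniteMeasure μ] [NullSingletonClass μ] :
    ∃ F : ℝ → ℝ, Continuous F ∧ ∀ a b, a ≤ b → μ.real (Set.Icc a b) = F b - F a := by
  have hint : ∀ a b : ℝ, IntervalIntegrable (fun _ => (1 : ℝ)) μ a b := fun a b => by simp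
  refine ⟨fun b => ∫ _ in (0 : ℝ)..b, (1 : ℝ) ∂μ,
    intervalIntegral.continuous_primitive hint 0, fun a b hab => ?_⟩
  rw [intervalIntegral.integral_interval_sub_left (hint _ _) (hint _ _),
    intervalIntegral.integral_const', Set.Ioc_eq_empty (not_lt.2 hab),
    measureReal_congr (Ioc_ae_eq_Icc (μ := μ) (a := a) (b := b)).symm]
  simp

/-- A positive maximin share is attained by a separated family of intervals. -/
theorem exists_isSepIntervals_sSup_le {n : ℕ} [NeZero n] {s : ℝ} (hs : 0 < s) (μ : Measure ℝ)
    [IsFiniteMeasure μ] [NullSingletonClass μ]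
    (hpos : 0 < sSup {t : ℝ | ∃ P : Fin n → Set ℝ,
      (∀ j, IsIntervalPiece (P j)) ∧ IsSepFamily s P ∧ t = ⨅ j : Fin n, (μ (P j)).toReal}) :
    ∃ a b : Fin n → ℝ, IsSepIntervals s a b ∧ ∀ j,
      sSup {t : ℝ | ∃ P : Fin n → Set ℝ, (∀ j, IsIntervalPiece (P j)) ∧ IsSepFamily s P ∧
        t = ⨅ j : Fin n, (μ (P j)).toReal} ≤ μ.real (Set.Icc (a j) (b j)) := by
  set S := {t : ℝ | ∃ P : Fin n → Set ℝ, (∀ j, IsIntervalPiece (P j)) ∧ IsSepFamily s P ∧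
    t = ⨅ j : Fin n, (μ (P j)).toReal}
  obtain ⟨F, hF, hμF⟩ := exists_continuous_measureReal_Icc_eq_sub μ
  let g : (Fin n → ℝ) × (Fin n → ℝ) → ℝ := fun p =>
    Finset.univ.inf' Finset.univ_nonempty fun j => F (p.2 j) - F (p.1 j)
  have hg : Continuous g := Continuous.finset_inf'_apply _ fun j _ => by fun_prop
  have key : ∀ t ∈ S, 0 < t → ∃ p : (Fin n → ℝ) × (Fin n → ℝ),
      IsSepIntervals s p.1 p.2 ∧ t ≤ g p := by
    rintro t ⟨P, hP, hsep, rfl⟩ ht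
    have hle : ∀ j, (⨅ j, (μ (P j)).toReal) ≤ (μ (P j)).toReal := fun j =>
      ciInf_le (Set.finite_range _).bddBelow j
    have hne : ∀ j, (P j).Nonempty := fun j => by
      by_contra h
      have := hle j
      rw [Set.not_nonempty_iff_eq_empty.1 h, measure_empty, ENNReal.toReal_zero] at this
      linarith
    obtain ⟨a, b, hab, hPab⟩ := exists_isSepIntervals hs hP hsep hne
    refine ⟨(a, b), hab, Finset.le_inf' _ _ fun j _ => ?_⟩
    rw [← hμF _ _ (hab.1 j).2.1, ← hPab]
    exact hle j
  have hSne : S.Nonempty := Set.nonempty_iff_ne_empty.2 fun h => by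
    rw [h, Real.sSup_empty] at hpos
    exact lt_irrefl _ hpos
  obtain ⟨t, htS, ht⟩ := exists_lt_of_lt_csSup hSne hpos
  obtain ⟨p, hp, htp⟩ := key t htS ht
  obtain ⟨q, hq, hmax⟩ := (isCompact_setOf_isSepIntervals s).exists_isMaxOn ⟨p, hp⟩ hg.continuousOn
  have hM : sSup S ≤ g q := csSup_le hSne fun u hu => by
    rcases lt_or_ge 0 u with h | h
    · obtain ⟨r, hr, hur⟩ := key u hu h
      exact hur.trans (hmax hr)
    · exact h.trans (ht.le.trans (htp.trans (hmax hp)))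
  refine ⟨q.1, q.2, hq, fun j => hM.trans ?_⟩
  rw [hμF _ _ (hq.1 j).2.1]
  exact Finset.inf'_le _ (Finset.mem_univ j)

/-- Moving-knife allocation: if each agent `i ∈ T` has at least `|T|` separated intervals to the
right of `x`, each worth at least `v i` to her, then the agents in `T` can be given separated
intervals to the right of `x` worth at least `v i`. -/
theorem exists_allocation_of_isSepIntervals {ι κ : Type*} [DecidableEq ι] [DecidableEq κ] {s : ℝ}
    (hs : 0 < s) (μ : ι → Measure ℝ) [∀ i, IsFiniteMeasure (μ i)] (v : ι → ℝ) (a b : ι → κ → ℝ)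
    (T : Finset ι) (hab : ∀ i ∈ T, IsSepIntervals s (a i) (b i))
    (hv : ∀ i ∈ T, ∀ j, v i ≤ (μ i).real (Set.Icc (a i j) (b i j)))
    (x : ℝ) (J : ι → Finset κ) (hJ : ∀ i ∈ T, T.card ≤ (J i).card)
    (hx : ∀ i ∈ T, ∀ j ∈ J i, x ≤ a i j) :
    ∃ l r : ι → ℝ,
      (∀ i ∈ T, x ≤ l i ∧ l i ≤ r i ∧ r i ≤ 1 ∧ v i ≤ (μ i).real (Set.Icc (l i) (r i))) ∧
      ∀ i ∈ T, ∀ k ∈ T, i ≠ k → r i + s ≤ l k ∨ r k + s ≤ l i := by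
  induction hc : T.card generalizing T x J with
  | zero =>
    rw [Finset.card_eq_zero] at hc
    subst hc
    exact ⟨0, 0, by simp, by simp⟩
  | succ m ih =>
    have hT : T.Nonempty := Finset.card_pos.1 (by omega)
    have hfirst : ∀ i, ∃ j, i ∈ T → j ∈ J i ∧ ∀ k ∈ J i, b i j ≤ b i k := fun i => by
      by_cases hi : i ∈ T
      · have hne : (J i).Nonempty := Finset.card_pos.1 (by have := hJ i hi; omega)
        obtain ⟨j, hj, hmin⟩ := (J i).exists_min_image (b i) hne
        exact ⟨j, fun _ => ⟨hj, hmin⟩⟩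
      · obtain ⟨i₀, hi₀⟩ := hT
        have hne : (J i₀).Nonempty := Finset.card_pos.1 (by have := hJ i₀ hi₀; omega)
        exact ⟨hne.choose, fun h => absurd h hi⟩
    choose f hf using hfirst
    obtain ⟨i₀, hi₀, hmin⟩ := T.exists_min_image (fun i => b i (f i)) hT
    set y := b i₀ (f i₀)
    have hxa : x ≤ a i₀ (f i₀) := hx i₀ hi₀ _ (hf i₀ hi₀).1
    have hay : a i₀ (f i₀) ≤ y := ((hab i₀ hi₀).1 _).2.1
    have hmem : ∀ {i}, i ∈ T.erase i₀ → i ∈ T := Finset.mem_of_mem_erase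
    obtain ⟨l, r, hlr, hsep⟩ := ih (T.erase i₀) (fun i hi => hab i (hmem hi))
      (fun i hi => hv i (hmem hi)) (y + s) (fun i => (J i).erase (f i))
      (fun i hi => by
        rw [Finset.card_erase_of_mem hi₀, Finset.card_erase_of_mem (hf i (hmem hi)).1]
        exact Nat.sub_le_sub_right (hJ i (hmem hi)) 1)
      (fun i hi j hj => by
        have hjJ := Finset.mem_of_mem_erase hj
        have h₁ : y ≤ b i (f i) := hmin i (hmem hi)
        have h₂ := (hf i (hmem hi)).2 j hjJ
        have h₃ := ((hab i (hmem hi)).1 (f i)).2.1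
        rcases (hab i (hmem hi)).2 (f i) j (Finset.ne_of_mem_erase hj).symm with h | h <;> linarith)
      (by rw [Finset.card_erase_of_mem hi₀, hc]; rfl)
    refine ⟨Function.update l i₀ x, Function.update r i₀ y, fun i hi => ?_, fun i hi k hk hik => ?_⟩
    · rcases eq_or_ne i i₀ with rfl | hne
      · simp only [Function.update_self]
        exact ⟨le_rfl, hxa.trans hay, ((hab i hi).1 _).2.2, (hv i hi (f i)).trans
          (measureReal_mono (Set.Icc_subset_Icc_left hxa))⟩
      · simp only [Function.update_of_ne hne]
        obtain ⟨h₁, h₂⟩ := hlr i (Finset.mem_erase.2 ⟨hne, hi⟩)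
        exact ⟨by linarith, h₂⟩
    · rcases eq_or_ne i i₀ with rfl | hi'
      · simp only [Function.update_self, Function.update_of_ne hik.symm]
        exact Or.inl (hlr k (Finset.mem_erase.2 ⟨hik.symm, hk⟩)).1
      rcases eq_or_ne k i₀ with rfl | hk'
      · simp only [Function.update_self, Function.update_of_ne hik]
        exact Or.inr (hlr i (Finset.mem_erase.2 ⟨hik, hi⟩)).1
      · simp only [Function.update_of_ne hi', Function.update_of_ne hk']
        exact hsep i (Finset.mem_erase.2 ⟨hi', hi⟩) k (Finset.mem_erase.2 ⟨hk', hk⟩) hik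

/-- STATEMENT 8: For `s > 0` and `n ≥ 1` agents with finite nonatomic Borel measures on ℝ,
there is an `s`-separated family of pieces of `[0,1]` giving every agent at least her
maximin share `MMS_i = sup` over `s`-separated families `(P_1,…,P_n)` of
`min_j μ_i(P_j)`. -/
theorem maximin_allocation_exists_interval_separated
    (s : ℝ) (hs : 0 < s) (n : ℕ) (hn : 1 ≤ n)
    (μ : Fin n → Measure ℝ) (hfin : ∀ i, IsFiniteMeasure (μ i))
    (hna : ∀ i (x : ℝ), μ i {x} = 0) :
    ∃ A : Fin n → Set ℝ,
      (∀ i, IsIntervalPiece (A i)) ∧ IsSepFamily s A ∧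
      ∀ i : Fin n,
        sSup {t : ℝ | ∃ P : Fin n → Set ℝ,
            (∀ j, IsIntervalPiece (P j)) ∧ IsSepFamily s P ∧
            t = ⨅ j : Fin n, (μ i (P j)).toReal}
          ≤ (μ i (A i)).toReal := by
  classical
  have : NeZero n := ⟨by omega⟩
  have : ∀ i, NullSingletonClass (μ i) := fun i => ⟨hna i⟩
  set v : Fin n → ℝ := fun i => sSup {t : ℝ | ∃ P : Fin n → Set ℝ,
    (∀ j, IsIntervalPiece (P j)) ∧ IsSepFamily s P ∧
    t = ⨅ j : Fin n, (μ i (P j)).toReal}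
  have hex : ∀ i, ∃ a b : Fin n → ℝ, 0 < v i →
      IsSepIntervals s a b ∧ ∀ j, v i ≤ (μ i).real (Set.Icc (a j) (b j)) := fun i => by
    by_cases hi : 0 < v i
    · obtain ⟨a, b, h⟩ := exists_isSepIntervals_sSup_le hs (μ i) hi
      exact ⟨a, b, fun _ => h⟩
    · exact ⟨0, 0, fun h => absurd h hi⟩
  choose a b hab using hex
  have hT : ∀ {i}, i ∈ Finset.univ.filter (fun i => 0 < v i) ↔ 0 < v i := by simp
  obtain ⟨l, r, hlr, hsep⟩ := exists_allocation_of_isSepIntervals hs μ v a b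
    (Finset.univ.filter fun i => 0 < v i) (fun i hi => (hab i (hT.1 hi)).1)
    (fun i hi => (hab i (hT.1 hi)).2) 0 (fun _ => Finset.univ)
    (fun _ _ => Finset.card_le_card (Finset.filter_subset _ _))
    (fun i hi j _ => ((hab i (hT.1 hi)).1.1 j).1)
  refine ⟨fun i => if 0 < v i then Set.Icc (l i) (r i) else ∅, fun i => ?_, fun i j hij => ?_,
    fun i => ?_⟩
  · by_cases hi : 0 < v i
    · obtain ⟨h₁, h₂, h₃, -⟩ := hlr i (hT.2 hi)
      exact Or.inr ⟨l i, r i, h₁, h₂, h₃, if_pos hi⟩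
    · exact Or.inl (if_neg hi)
  · by_cases hi : 0 < v i
    · by_cases hj : 0 < v j
      · simp only [if_pos hi, if_pos hj]
        exact (sep_Icc_iff hs (hlr i (hT.2 hi)).2.1 (hlr j (hT.2 hj)).2.1).2
          (hsep i (hT.2 hi) j (hT.2 hj) hij)
      · simp [hj]
    · simp [hi]
  · change v i ≤ _
    by_cases hi : 0 < v i
    · simp only [if_pos hi]
      exact (hlr i (hT.2 hi)).2.2.2
    · exact (not_lt.1 hi).trans ENNReal.toReal_nonneg
end

section
/- Let s > 0, n ≥ 1, m ≥ 1, and let K = [a_1,b_1] ∪ … ∪ [a_m,b_m] be a union of m pairwise disjoint closed bounded intervals in ℝ. A piece is a subset of K that is either empty or a closed interval [a,b] ⊆ K with a ≤ b. For each agent i ∈ {1,…,n}, let v_i be a nonnegative real-valued valuation defined on pieces with v_i(∅) = 0, which is monotone (if P ⊆ Q are pieces then v_i(P) ≤ v_i(Q)) and continuous as a function of the endpoints (a,b) on the set {(a,b) : a ≤ b, [a,b] ⊆ K}. Define MMS_i := sup over all s-separated families (P_1,…,P_n) of pieces of min_{1≤j≤n} v_i(P_j). Then there exists an s-separated family (A_1,…,A_n)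 of pieces such that v_i(A_i) ≥ MMS_i for every i. -/
/-- A piece of the cake `K`: either empty or a closed interval `[a,b] ⊆ K` with `a ≤ b`. -/
def IsPieceOf (K : Set ℝ) (P : Set ℝ) : Prop :=
  P = ∅ ∨ ∃ a b : ℝ, a ≤ b ∧ Set.Icc a b ⊆ K ∧ P = Set.Icc a b

open Set

/-- Two intervals, given by their endpoints, one of which lies at least `s` to the right of the
other. -/
def IntervalSep (s : ℝ) (p q : ℝ × ℝ) : Prop :=
  p.2 + s ≤ q.1 ∨ q.2 + s ≤ p.1

theorem IntervalSep.le_dist {s : ℝ} {p q : ℝ × ℝ} (h : IntervalSep s p q) {x y : ℝ}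
    (hx : x ∈ Icc p.1 p.2) (hy : y ∈ Icc q.1 q.2) : s ≤ dist x y := by
  obtain ⟨hx1, hx2⟩ := hx
  obtain ⟨hy1, hy2⟩ := hy
  rw [Real.dist_eq, le_abs]
  rcases h with h | h
  · right; linarith
  · left; linarith

theorem intervalSep_of_forall_le_dist {s : ℝ} (hs : 0 < s) {p q : ℝ × ℝ}
    (hp : p.1 ≤ p.2) (hq : q.1 ≤ q.2)
    (h : ∀ x ∈ Icc p.1 p.2, ∀ y ∈ Icc q.1 q.2, s ≤ dist x y) : IntervalSep s p q := by
  rcases le_total p.1 q.1 with hpq | hqp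
  · left
    rcases le_or_gt q.1 p.2 with h1 | h1
    · have := h q.1 ⟨hpq, h1⟩ q.1 ⟨le_rfl, hq⟩
      rw [dist_self] at this
      linarith
    · have := h p.2 ⟨hp, le_rfl⟩ q.1 ⟨le_rfl, hq⟩
      rw [Real.dist_eq, abs_of_neg (by linarith)] at this
      linarith
  · right
    rcases le_or_gt p.1 q.2 with h1 | h1
    · have := h p.1 ⟨le_rfl, hp⟩ p.1 ⟨hqp, h1⟩
      rw [dist_self] at this
      linarith
    · have := h p.1 ⟨le_rfl, hp⟩ q.2 ⟨hq, le_rfl⟩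
      rw [Real.dist_eq, abs_of_pos (by linarith)] at this
      linarith

/-- If every agent of `A` has at least `|A|` pairwise separated intervals, then one can select one
interval of each agent so that the selected intervals are pairwise separated. -/
theorem exists_intervalSep_selection {ι κ : Type*} {s : ℝ} (hs : 0 < s) (p : ι → κ → ℝ × ℝ)
    (A : Finset ι) (J : ι → Finset κ) (hcard : ∀ i ∈ A, A.card ≤ (J i).card)
    (hp : ∀ i ∈ A, ∀ j ∈ J i, (p i j).1 ≤ (p i j).2)
    (hsep : ∀ i ∈ A, ∀ j ∈ J i, ∀ j' ∈ J i, j ≠ j' → IntervalSep s (p i j) (p i j')) :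
    ∃ g : ∀ i ∈ A, κ, (∀ i hi, g i hi ∈ J i) ∧
      ∀ i hi i' hi', i ≠ i' → IntervalSep s (p i (g i hi)) (p i' (g i' hi')) := by
  classical
  induction hk : A.card generalizing A J with
  | zero =>
    obtain rfl := Finset.card_eq_zero.1 hk
    exact ⟨fun i hi => absurd hi (Finset.notMem_empty i),
      fun i hi => absurd hi (Finset.notMem_empty i),
      fun i hi => absurd hi (Finset.notMem_empty i)⟩
  | succ k ih =>
    have hA : A.Nonempty := Finset.card_pos.1 (by omega)
    have hJ : ∀ i ∈ A, (J i).Nonempty := fun i hi => by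
      have := hcard i hi
      exact Finset.card_pos.1 (by omega)
    have hne : (A.sigma J).Nonempty := by
      obtain ⟨i, hi⟩ := hA
      obtain ⟨j, hj⟩ := hJ i hi
      exact ⟨⟨i, j⟩, Finset.mem_sigma.2 ⟨hi, hj⟩⟩
    obtain ⟨⟨i₀, j₀⟩, hmem, hmin⟩ :=
      Finset.exists_min_image (A.sigma J) (fun x => (p x.1 x.2).2) hne
    obtain ⟨hi₀, hj₀⟩ := Finset.mem_sigma.1 hmem
    have hcard' : ∀ i ∈ A, k ≤ ((J i).filter fun j => (p i₀ j₀).2 + s ≤ (p i j).1).card := by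
      intro i hi
      obtain ⟨j₁, hj₁, hj₁min⟩ := Finset.exists_min_image (J i) (fun j => (p i j).2) (hJ i hi)
      have hsub : (J i).erase j₁ ⊆ (J i).filter fun j => (p i₀ j₀).2 + s ≤ (p i j).1 := by
        intro j hj
        obtain ⟨hjne, hj⟩ := Finset.mem_erase.1 hj
        refine Finset.mem_filter.2 ⟨hj, ?_⟩
        have h1 : (p i₀ j₀).2 ≤ (p i j₁).2 := hmin ⟨i, j₁⟩ (Finset.mem_sigma.2 ⟨hi, hj₁⟩)
        have h2 := hj₁min j hj
        have h3 := hp i hi j₁ hj₁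
        rcases hsep i hi j₁ hj₁ j hj hjne.symm with h | h <;> linarith
      have h1 := Finset.card_le_card hsub
      rw [Finset.card_erase_of_mem hj₁] at h1
      have := hcard i hi
      omega
    obtain ⟨g, hgJ, hgsep⟩ := ih (A.erase i₀)
      (fun i => (J i).filter fun j => (p i₀ j₀).2 + s ≤ (p i j).1)
      (fun i hi => by
        rw [Finset.card_erase_of_mem hi₀, hk]
        exact hcard' i (Finset.mem_of_mem_erase hi))
      (fun i hi j hj => hp i (Finset.mem_of_mem_erase hi) j (Finset.mem_filter.1 hj).1)
      (fun i hi j hj j' hj' => hsep i (Finset.mem_of_mem_erase hi)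
        j (Finset.mem_filter.1 hj).1 j' (Finset.mem_filter.1 hj').1)
      (by rw [Finset.card_erase_of_mem hi₀, hk]; rfl)
    refine ⟨fun i hi => if h : i = i₀ then j₀ else g i (Finset.mem_erase.2 ⟨h, hi⟩), ?_, ?_⟩
    · intro i hi
      by_cases h : i = i₀
      · subst h; simpa using hj₀
      · simpa [h] using (Finset.mem_filter.1 (hgJ i (Finset.mem_erase.2 ⟨h, hi⟩))).1
    · intro i hi i' hi' hii
      by_cases h : i = i₀
      · subst h
        have h' : i' ≠ i := hii.symm
        simpa [h', IntervalSep] using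
          Or.inl (Finset.mem_filter.1 (hgJ i' (Finset.mem_erase.2 ⟨h', hi'⟩))).2
      · by_cases h' : i' = i₀
        · subst h'
          simpa [h, IntervalSep] using
            Or.inr (Finset.mem_filter.1 (hgJ i (Finset.mem_erase.2 ⟨h, hi⟩))).2
        · simpa [h, h'] using hgsep i (Finset.mem_erase.2 ⟨h, hi⟩) i'
            (Finset.mem_erase.2 ⟨h', hi'⟩) hii

theorem isCompact_setOf_Icc_subset {K : Set ℝ} (hK : IsCompact K) :
    IsCompact {p : ℝ × ℝ | p.1 ≤ p.2 ∧ Icc p.1 p.2 ⊆ K} := by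
  have heq : {p : ℝ × ℝ | p.1 ≤ p.2 ∧ Icc p.1 p.2 ⊆ K} =
      {p : ℝ × ℝ | p.1 ≤ p.2} ∩
        ⋂ u ∈ Icc (0 : ℝ) 1, (fun p : ℝ × ℝ => p.1 + u • (p.2 - p.1)) ⁻¹' K := by
    ext p
    simp only [mem_ofPred_eq, mem_inter_iff, mem_iInter, mem_preimage]
    refine and_congr_right fun hp => ?_
    rw [← segment_eq_Icc hp, segment_eq_image', image_subset_iff]
    rfl
  refine (hK.prod hK).of_isClosed_subset ?_ fun p hp =>
    ⟨hp.2 ⟨le_rfl, hp.1⟩, hp.2 ⟨hp.1, le_rfl⟩⟩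
  rw [heq]
  exact (isClosed_le continuous_fst continuous_snd).inter
    (isClosed_biInter fun u _ => hK.isClosed.preimage (by fun_prop))

theorem isCompact_setOf_intervalSep {κ : Type*} (s : ℝ) {S : Set (ℝ × ℝ)} (hS : IsCompact S) :
    IsCompact {p : κ → ℝ × ℝ | (∀ j, p j ∈ S) ∧
      ∀ j j', j ≠ j' → IntervalSep s (p j) (p j')} := by
  have hclosed : IsClosed {p : κ → ℝ × ℝ | ∀ j j', j ≠ j' → IntervalSep s (p j) (p j')} := by
    simp only [ofPred_forall]
    exact isClosed_iInter fun j => isClosed_iInter fun j' => isClosed_iInter fun _ =>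
      (isClosed_le (f := fun p : κ → ℝ × ℝ => (p j).2 + s) (g := fun p => (p j').1)
        (by fun_prop) (by fun_prop)).union
      (isClosed_le (f := fun p : κ → ℝ × ℝ => (p j').2 + s) (g := fun p => (p j).1)
        (by fun_prop) (by fun_prop))
  convert (isCompact_univ_pi fun _ : κ => hS).inter_right hclosed using 1
  ext p
  simp

/-- A positive maximin share is attained by a family of nonempty pieces. -/
theorem exists_intervals_maximin_share_le {n : ℕ} (hn : 1 ≤ n) {s : ℝ} (hs : 0 < s) {K : Set ℝ}
    (hK : IsCompact K) (w : Set ℝ → ℝ) (hw0 : w ∅ = 0)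
    (hcont : ContinuousOn (fun p : ℝ × ℝ => w (Icc p.1 p.2))
      {p : ℝ × ℝ | p.1 ≤ p.2 ∧ Icc p.1 p.2 ⊆ K})
    (hpos : 0 < sSup {t : ℝ | ∃ P : Fin n → Set ℝ,
            (∀ j, IsPieceOf K (P j)) ∧ IsSepFamily s P ∧ t = ⨅ j : Fin n, w (P j)}) :
    ∃ p : Fin n → ℝ × ℝ, (∀ j, (p j).1 ≤ (p j).2 ∧ Icc (p j).1 (p j).2 ⊆ K) ∧
      (∀ j j', j ≠ j' → IntervalSep s (p j) (p j')) ∧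
      ∀ j, sSup {t : ℝ | ∃ P : Fin n → Set ℝ,
            (∀ j, IsPieceOf K (P j)) ∧ IsSepFamily s P ∧ t = ⨅ j : Fin n, w (P j)}
          ≤ w (Icc (p j).1 (p j).2) := by
  have : NeZero n := ⟨by omega⟩
  set T := {t : ℝ | ∃ P : Fin n → Set ℝ,
            (∀ j, IsPieceOf K (P j)) ∧ IsSepFamily s P ∧ t = ⨅ j : Fin n, w (P j)}
  set S := {p : ℝ × ℝ | p.1 ≤ p.2 ∧ Icc p.1 p.2 ⊆ K}
  set C := {p : Fin n → ℝ × ℝ | (∀ j, p j ∈ S) ∧ ∀ j j', j ≠ j' → IntervalSep s (p j) (p j')}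
  let f : (Fin n → ℝ × ℝ) → ℝ := fun p => ⨅ j, w (Icc (p j).1 (p j).2)
  have hC : IsCompact C := isCompact_setOf_intervalSep s (isCompact_setOf_Icc_subset hK)
  have hf : ContinuousOn f C := by
    have : f = fun p => Finset.univ.inf' Finset.univ_nonempty
        fun j => w (Icc (p j).1 (p j).2) := by
      funext p
      exact (Finset.inf'_univ_eq_ciInf _).symm
    rw [this]
    exact ContinuousOn.finset_inf'_apply _ fun j _ =>
      hcont.comp (continuous_apply j).continuousOn fun p hp => hp.1 j
  have hrep : ∀ t ∈ T, 0 < t → ∃ p ∈ C, t = f p := by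
    rintro t ⟨P, hP, hPs, rfl⟩ ht
    have hex : ∀ j, ∃ q : ℝ × ℝ, q ∈ S ∧ P j = Icc q.1 q.2 := by
      intro j
      rcases hP j with h | ⟨x, y, hxy, hsub, h⟩
      · have := ciInf_le (finite_range fun j => w (P j)).bddBelow j
        simp only [h, hw0] at this
        linarith
      · exact ⟨(x, y), ⟨hxy, hsub⟩, h⟩
    choose p hpS hp using hex
    refine ⟨p, ⟨hpS, fun j j' hjj => ?_⟩, by simp only [f, hp]⟩
    have := hPs j j' hjj
    rw [hp, hp] at this
    exact intervalSep_of_forall_le_dist hs (hpS j).1 (hpS j').1 this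
  have hTne : T.Nonempty := by
    by_contra h
    rw [not_nonempty_iff_eq_empty.1 h, Real.sSup_empty] at hpos
    exact lt_irrefl _ hpos
  obtain ⟨t₀, ht₀, ht₀pos⟩ := exists_lt_of_lt_csSup hTne hpos
  obtain ⟨p₀, hp₀, rfl⟩ := hrep t₀ ht₀ ht₀pos
  obtain ⟨q, hqC, hqmax⟩ := hC.exists_isMaxOn ⟨p₀, hp₀⟩ hf
  have hle : sSup T ≤ f q := by
    refine csSup_le hTne fun t ht => ?_
    rcases le_or_gt t 0 with h | h
    · exact h.trans (ht₀pos.le.trans (hqmax hp₀))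
    · obtain ⟨p, hp, rfl⟩ := hrep t ht h
      exact hqmax hp
  exact ⟨q, hqC.1, hqC.2, fun j => hle.trans
    (ciInf_le (finite_range fun j => w (Icc (q j).1 (q j).2)).bddBelow j)⟩

/-- STATEMENT 9: Let `K` be a union of `m` pairwise disjoint closed bounded intervals,
and let `n ≥ 1` agents have nonnegative, monotone valuations over pieces of `K`
(empty or closed subintervals of `K`), vanishing on the empty piece and continuous in
the endpoints. For any `s > 0`, there is an `s`-separated family of pieces giving every
agent at least her maximin share. -/
theorem maximin_allocation_exists_union_of_intervals_separated
    (s : ℝ) (hs : 0 < s) (n m : ℕ) (hn : 1 ≤ n) (hm : 1 ≤ m)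
    (a b : Fin m → ℝ) (hab : ∀ j, a j ≤ b j)
    (hdisj : ∀ j j' : Fin m, j ≠ j' →
      Disjoint (Set.Icc (a j) (b j)) (Set.Icc (a j') (b j')))
    (K : Set ℝ) (hK : K = ⋃ j : Fin m, Set.Icc (a j) (b j))
    (v : Fin n → Set ℝ → ℝ)
    (hv0 : ∀ i, v i ∅ = 0)
    (hvnonneg : ∀ i P, IsPieceOf K P → 0 ≤ v i P)
    (hmono : ∀ i P Q, IsPieceOf K P → IsPieceOf K Q → P ⊆ Q → v i P ≤ v i Q)
    (hcont : ∀ i, ContinuousOn (fun p : ℝ × ℝ => v i (Set.Icc p.1 p.2))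
      {p : ℝ × ℝ | p.1 ≤ p.2 ∧ Set.Icc p.1 p.2 ⊆ K}) :
    ∃ A : Fin n → Set ℝ,
      (∀ i, IsPieceOf K (A i)) ∧ IsSepFamily s A ∧
      ∀ i : Fin n,
        sSup {t : ℝ | ∃ P : Fin n → Set ℝ,
            (∀ j, IsPieceOf K (P j)) ∧ IsSepFamily s P ∧
            t = ⨅ j : Fin n, v i (P j)}
          ≤ v i (A i) := by
  classical
  have hKc : IsCompact K := hK ▸ isCompact_iUnion fun j => isCompact_Icc
  let M : Fin n → ℝ := fun i => sSup {t : ℝ | ∃ P : Fin n → Set ℝ,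
    (∀ j, IsPieceOf K (P j)) ∧ IsSepFamily s P ∧ t = ⨅ j : Fin n, v i (P j)}
  have hex : ∀ i, ∃ p : Fin n → ℝ × ℝ, 0 < M i →
      (∀ j, (p j).1 ≤ (p j).2 ∧ Icc (p j).1 (p j).2 ⊆ K) ∧
      (∀ j j', j ≠ j' → IntervalSep s (p j) (p j')) ∧
      ∀ j, M i ≤ v i (Icc (p j).1 (p j).2) := by
    intro i
    by_cases h : 0 < M i
    · obtain ⟨p, hp⟩ := exists_intervals_maximin_share_le hn hs hKc (v i) (hv0 i) (hcont i) h
      exact ⟨p, fun _ => hp⟩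
    · exact ⟨fun _ => 0, fun h' => absurd h' h⟩
  choose p hp using hex
  have hmem : ∀ i, i ∈ Finset.univ.filter (fun i => 0 < M i) ↔ 0 < M i := by simp
  obtain ⟨g, -, hg⟩ := exists_intervalSep_selection hs p
    (Finset.univ.filter fun i => 0 < M i) (fun _ => Finset.univ)
    (fun i _ => Finset.card_le_univ _)
    (fun i hi j _ => ((hp i ((hmem i).1 hi)).1 j).1)
    (fun i hi j _ j' _ => (hp i ((hmem i).1 hi)).2.1 j j')
  refine ⟨fun i => if h : 0 < M i then
    Icc (p i (g i ((hmem i).2 h))).1 (p i (g i ((hmem i).2 h))).2 else ∅, ?_, ?_, ?_⟩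
  · intro i
    by_cases h : 0 < M i
    · simp only [h, dite_true]
      exact Or.inr ⟨_, _, ((hp i h).1 _).1, ((hp i h).1 _).2, rfl⟩
    · simp only [h, dite_false]
      exact Or.inl rfl
  · intro i i' hii x hx y hy
    by_cases h : 0 < M i
    · by_cases h' : 0 < M i'
      · simp only [h, dite_true] at hx
        simp only [h', dite_true] at hy
        exact (hg i ((hmem i).2 h) i' ((hmem i').2 h') hii).le_dist hx hy
      · simp [h'] at hy
    · simp [h] at hx
  · intro i
    change M i ≤ _
    by_cases h : 0 < M i
    · simp only [h, dite_true]
      exact (hp i h).2.2 _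
    · simp only [h, dite_false, hv0]
      exact not_lt.1 h
end
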